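/- For every even integer k ≥ 10, the graph H_k is 5-regular: every vertex of H_k has degree exactly 5. -/

import Mathlib

open SimpleGraph

/-- Vertex type of the graph `H_k`: four disjoint families
`b_i` (`i` mod `k`), `u_j` (`j` mod `3k`), `v_j` (`j` mod `3k`), `a_i` (`i` mod `k`). -/
inductive HkV (k : ℕ) : Type where
  | b : ZMod k → HkV k
  | u : ZMod (3 * k) → HkV k
  | v : ZMod (3 * k) → HkV k
  | a : ZMod k → HkV k
deriving DecidableEq

/-- The natural map sending the residue `i` mod `k` to the residue `3 i` mod `3 k`. -/
def HkV.tr (k : ℕ) (i : ZMod k) : ZMod (3 * k) := 3 * (i.val : ZMod (3 * k))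

/-- The base edge relation of `H_k`: the four cycles
`b_1 ⋯ b_k`, `u_1 ⋯ u_{3k}`, `v_1 ⋯ v_{3k}`, `a_1 ⋯ a_k`, together with the edges
`b_i u_{3i-2}`, `b_i u_{3i}`, `b_i u_{3i+2}`, the edges `u_j v_{j-1}`, `u_j v_{j+1}`,
and the edges `a_i v_{3i-2}`, `a_i v_{3i}`, `a_i v_{3i+2}` (indices modulo `k`
resp. `3k`). -/
def hkRel (k : ℕ) : HkV k → HkV k → Prop
  | .b i, .b i' => i' = i + 1
  | .u j, .u j' => j' = j + 1
  | .v j, .v j' => j' = j + 1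
  | .a i, .a i' => i' = i + 1
  | .b i, .u j => j = HkV.tr k i - 2 ∨ j = HkV.tr k i ∨ j = HkV.tr k i + 2
  | .u j, .v j' => j' = j - 1 ∨ j' = j + 1
  | .a i, .v j => j = HkV.tr k i - 2 ∨ j = HkV.tr k i ∨ j = HkV.tr k i + 2
  | _, _ => False

/-- The graph `H_k` from the paper. -/
def Hk (k : ℕ) : SimpleGraph (HkV k) := SimpleGraph.fromRel (hkRel k)

theorem HkV.tr_intCast (k : ℕ) [NeZero k] (m : ℤ) :
    HkV.tr k (m : ZMod k) = ((3 * m : ℤ) : ZMod (3 * k)) := by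
  have h : ((m : ZMod k).val : ℤ) = m % k := ZMod.val_intCast m
  have h' : HkV.tr k (m : ZMod k) = ((3 * ((m : ZMod k).val : ℤ) : ℤ) : ZMod (3 * k)) := by
    simp [HkV.tr]
  rw [h', h, ZMod.intCast_eq_intCast_iff_dvd_sub]
  refine ⟨m / k, ?_⟩
  push_cast
  linear_combination 3 * (Int.emod_add_mul_ediv m k).symm

/-- Every residue mod `3k` has the form `3i - 2`, `3i` or `3i + 2` for exactly one `i` mod `k`. -/
theorem HkV.exists_forall_tr_iff (k : ℕ) [NeZero k] (j : ZMod (3 * k)) :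
    ∃ i : ZMod k, ∀ i' : ZMod k,
      (j = HkV.tr k i' - 2 ∨ j = HkV.tr k i' ∨ j = HkV.tr k i' + 2) ↔ i' = i := by
  obtain ⟨n, rfl⟩ := ZMod.intCast_surjective j
  obtain ⟨m, hm⟩ : ∃ m : ℤ, n = 3 * m - 2 ∨ n = 3 * m ∨ n = 3 * m + 2 := by
    have h : n % 3 = 0 ∨ n % 3 = 1 ∨ n % 3 = 2 := by omega
    rcases h with h | h | h
    · exact ⟨n / 3, by omega⟩
    · exact ⟨n / 3 + 1, by omega⟩
    · exact ⟨n / 3, by omega⟩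
  refine ⟨(m : ZMod k), fun i' => ⟨fun h => ?_, ?_⟩⟩
  · obtain ⟨m', rfl⟩ := ZMod.intCast_surjective i'
    rw [HkV.tr_intCast] at h
    have h' : ∃ r : ℤ, (r = -2 ∨ r = 0 ∨ r = 2) ∧
        (n : ZMod (3 * k)) = ((3 * m' + r : ℤ) : ZMod (3 * k)) := by
      rcases h with h | h | h
      · exact ⟨-2, by simp, by rw [h]; push_cast; ring⟩
      · exact ⟨0, by simp, by rw [h]; simp⟩
      · exact ⟨2, by simp, by rw [h]; push_cast; ring⟩
    obtain ⟨r, hr, h⟩ := h'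
    rw [ZMod.intCast_eq_intCast_iff_dvd_sub] at h ⊢
    obtain ⟨c, hc⟩ := h
    refine ⟨-c, ?_⟩
    push_cast at hc
    rw [mul_assoc] at hc
    rw [mul_neg]
    generalize (k : ℤ) * c = t at *
    omega
  · rintro rfl
    rw [HkV.tr_intCast]
    rcases hm with rfl | rfl | rfl <;> simp

theorem ZMod.add_natCast_ne_sub_natCast {n c : ℕ} (hc : 0 < c) (h : 2 * c < n) (x : ZMod n) :
    x + c ≠ x - c := by
  intro hx
  have h0 : ((2 * c : ℕ) : ZMod n) = 0 := by
    push_cast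
    linear_combination hx
  rw [ZMod.natCast_eq_zero_iff] at h0
  exact Nat.not_dvd_of_pos_of_lt (by omega) h h0

theorem Set.ncard_eq_five_of_forall_mem_iff {α : Type*} {S : Set α} (p q r s t : α)
    (h : ∀ y, y ∈ S ↔ y = p ∨ y = q ∨ y = r ∨ y = s ∨ y = t)
    (hn : [p, q, r, s, t].Nodup) : S.ncard = 5 := by
  classical
  have hS : S = ↑([p, q, r, s, t].toFinset) := by ext y; simp [h]
  rw [hS, Set.ncard_coe_finset, List.toFinset_card_of_nodup hn]
  rfl

/-- for every even integer `k ≥ 10`, the graph `H_k` is 5-regular: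
every vertex has exactly 5 neighbors. -/
theorem Hk_five_regular (k : ℕ) (hk : 10 ≤ k) (hke : Even k) :
    ∀ x : HkV k, ((Hk k).neighborSet x).ncard = 5 := by
  have : NeZero k := ⟨by omega⟩
  have : Fact (1 < k) := ⟨by omega⟩
  have : Fact (1 < 3 * k) := ⟨by omega⟩
  have hk1 : ∀ x : ZMod k, x + 1 ≠ x - 1 := fun x => by
    exact_mod_cast ZMod.add_natCast_ne_sub_natCast (c := 1) (by omega) (by omega) x
  have h3k1 : ∀ x : ZMod (3 * k), x + 1 ≠ x - 1 := fun x => by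
    exact_mod_cast ZMod.add_natCast_ne_sub_natCast (c := 1) (by omega) (by omega) x
  have h3k2 : ∀ x : ZMod (3 * k), x + 2 ≠ x - 2 := fun x => by
    exact_mod_cast ZMod.add_natCast_ne_sub_natCast (c := 2) (by omega) (by omega) x
  have h2 : (2 : ZMod (3 * k)) ≠ 0 := fun h => h3k2 0 (by simp [h])
  rintro (i | j | j | i)
  · apply Set.ncard_eq_five_of_forall_mem_iff (.b (i + 1)) (.b (i - 1)) (.u (HkV.tr k i - 2))
      (.u (HkV.tr k i)) (.u (HkV.tr k i + 2))
    · rintro (y | y | y | y) <;> simp [Hk, hkRel]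
      grind
    · simp [hk1, h2, (h3k2 _).symm]
  · obtain ⟨i, hi⟩ := HkV.exists_forall_tr_iff k j
    apply Set.ncard_eq_five_of_forall_mem_iff (.u (j + 1)) (.u (j - 1)) (.v (j + 1)) (.v (j - 1))
      (.b i)
    · rintro (y | y | y | y) <;> simp [Hk, hkRel, hi]
      all_goals grind
    · simp [h3k1]
  · obtain ⟨i, hi⟩ := HkV.exists_forall_tr_iff k j
    apply Set.ncard_eq_five_of_forall_mem_iff (.v (j + 1)) (.v (j - 1)) (.u (j + 1)) (.u (j - 1))
      (.a i)
    · rintro (y | y | y | y) <;> simp [Hk, hkRel, hi]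
      all_goals grind
    · simp [h3k1]
  · apply Set.ncard_eq_five_of_forall_mem_iff (.a (i + 1)) (.a (i - 1)) (.v (HkV.tr k i - 2))
      (.v (HkV.tr k i)) (.v (HkV.tr k i + 2))
    · rintro (y | y | y | y) <;> simp [Hk, hkRel]
      grind
    · simp [hk1, h2, (h3k2 _).symm]
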